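/- Let G be a finite simple graph and let G' be the graph obtained from G by replacing every edge {u,v} of G by two internally disjoint paths from u to v, one of length 2 and one of length 3, using distinct new internal vertices for distinct edges. Let H₈ denote the 8-vertex graph consisting of a 7-cycle together with one additional pendant vertex adjacent to exactly one vertex of the cycle ('C₇ with a tail'). Then G contains no triangle if and only if G' contains no subgraph isomorphic to H₈. -/

import Mathlib

/-- An (arbitrarily chosen) ordered pair of the two endpoints of an edge. -/
noncomputable def Sym2.ends {V : Type*} (e : Sym2 V) : V × V := Quot.out e

/-- The graph obtained from `G` by replacing every edge `{u,v}` of `G` by two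
internally disjoint paths from `u` to `v`, one of length `ℓ` (through the `ℓ - 1`
new internal vertices `(e, i)` for `i : Fin (ℓ - 1)`) and one of length `ℓ + 1`
(through the `ℓ` further new internal vertices `(e, i)` for `i : Fin ℓ`), with
distinct new internal vertices for distinct edges. -/
noncomputable def SimpleGraph.doublePathSubdivision {V : Type*} (G : SimpleGraph V) (ℓ : ℕ) :
    SimpleGraph (V ⊕ ((G.edgeSet × Fin (ℓ - 1)) ⊕ (G.edgeSet × Fin ℓ))) :=
  SimpleGraph.fromRel fun x y =>
    match x, y with
    | Sum.inl u, Sum.inr (Sum.inl (e, i)) =>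
        (u = (Sym2.ends e.1).1 ∧ (i : ℕ) = 0) ∨ (u = (Sym2.ends e.1).2 ∧ (i : ℕ) = ℓ - 2)
    | Sum.inl u, Sum.inr (Sum.inr (e, i)) =>
        (u = (Sym2.ends e.1).1 ∧ (i : ℕ) = 0) ∨ (u = (Sym2.ends e.1).2 ∧ (i : ℕ) = ℓ - 1)
    | Sum.inr (Sum.inl (e, i)), Sum.inr (Sum.inl (e', j)) => e = e' ∧ (j : ℕ) = (i : ℕ) + 1
    | Sum.inr (Sum.inr (e, i)), Sum.inr (Sum.inr (e', j)) => e = e' ∧ (j : ℕ) = (i : ℕ) + 1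
    | _, _ => False

/-- The graph `C₇` with a tail: the 8-vertex graph consisting of the 7-cycle on the
vertices `0, 1, …, 6` together with the pendant vertex `7` adjacent exactly to the
cycle vertex `0`. -/
def tailedC7 : SimpleGraph (Fin 8) :=
  SimpleGraph.fromRel fun a b =>
    ((a : ℕ) < 7 ∧ (b : ℕ) < 7 ∧ ((a : ℕ) + 1) % 7 = (b : ℕ)) ∨ ((a : ℕ) = 7 ∧ (b : ℕ) = 0)

namespace SimpleGraph

variable {V : Type*} {G : SimpleGraph V}

lemma mk_ends (e : Sym2 V) : s((Sym2.ends e).1, (Sym2.ends e).2) = e :=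
  Quot.out_eq e

lemma adj_ends (e : G.edgeSet) : G.Adj (Sym2.ends e.1).1 (Sym2.ends e.1).2 := by
  rw [← mem_edgeSet, mk_ends]
  exact e.2

lemma mem_edge_iff_ends {u : V} {e : Sym2 V} :
    u ∈ e ↔ u = (Sym2.ends e).1 ∨ u = (Sym2.ends e).2 := by
  conv_lhs => rw [← mk_ends e]
  exact Sym2.mem_iff

lemma doublePathSubdivision_not_adj_inl_inl {u v : V} :
    ¬ (G.doublePathSubdivision 2).Adj (Sum.inl u) (Sum.inl v) := by
  simp [doublePathSubdivision]

lemma doublePathSubdivision_adj_inl_short {u : V} {e : G.edgeSet} {i : Fin 1} :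
    (G.doublePathSubdivision 2).Adj (Sum.inl u) (Sum.inr (Sum.inl (e, i))) ↔ u ∈ e.1 := by
  simp [doublePathSubdivision, mem_edge_iff_ends]

lemma doublePathSubdivision_adj_inl_long {u : V} {e : G.edgeSet} {i : Fin 2} :
    (G.doublePathSubdivision 2).Adj (Sum.inl u) (Sum.inr (Sum.inr (e, i))) ↔
      (u = (Sym2.ends e.1).1 ∧ i = 0) ∨ (u = (Sym2.ends e.1).2 ∧ i = 1) := by
  fin_cases i <;> simp [doublePathSubdivision]

lemma doublePathSubdivision_not_adj_short_short {p q : G.edgeSet × Fin 1} :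
    ¬ (G.doublePathSubdivision 2).Adj (Sum.inr (Sum.inl p)) (Sum.inr (Sum.inl q)) := by
  simp [doublePathSubdivision]

lemma doublePathSubdivision_not_adj_short_long {p : G.edgeSet × Fin 1} {q : G.edgeSet × Fin 2} :
    ¬ (G.doublePathSubdivision 2).Adj (Sum.inr (Sum.inl p)) (Sum.inr (Sum.inr q)) := by
  simp [doublePathSubdivision]

lemma doublePathSubdivision_adj_long_long {e e' : G.edgeSet} {i j : Fin 2} :
    (G.doublePathSubdivision 2).Adj (Sum.inr (Sum.inr (e, i))) (Sum.inr (Sum.inr (e', j))) ↔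
      e = e' ∧ i ≠ j := by
  simp only [doublePathSubdivision, fromRel_adj]
  constructor
  · rintro ⟨-, ⟨rfl, h⟩ | ⟨rfl, h⟩⟩ <;> exact ⟨rfl, by omega⟩
  · rintro ⟨rfl, h⟩
    exact ⟨by simpa using h, by simp; omega⟩

/-- A path leaving an original vertex of `G` reaches an adjacent original vertex after two or
three steps. -/
lemma exists_adj_of_doublePathSubdivision_path {u : V}
    {x y z : V ⊕ ((G.edgeSet × Fin (2 - 1)) ⊕ (G.edgeSet × Fin 2))}
    (hux : (G.doublePathSubdivision 2).Adj (Sum.inl u) x)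
    (hxy : (G.doublePathSubdivision 2).Adj x y) (hyz : (G.doublePathSubdivision 2).Adj y z)
    (huy : Sum.inl u ≠ y) (hxz : x ≠ z) :
    ∃ v, G.Adj u v ∧ (y = Sum.inl v ∨ z = Sum.inl v) := by
  rcases x with x | ⟨e, i⟩ | ⟨e, i⟩
  · exact absurd hux doublePathSubdivision_not_adj_inl_inl
  · rcases y with v | q | q
    · have hu : u ∈ e.1 := doublePathSubdivision_adj_inl_short.1 hux
      have hv : v ∈ e.1 := doublePathSubdivision_adj_inl_short.1 hxy.symm
      have huv : u ≠ v := fun h => huy (congrArg _ h)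
      refine ⟨v, ?_, Or.inl rfl⟩
      rw [← mem_edgeSet, ← (Sym2.mem_and_mem_iff huv).1 ⟨hu, hv⟩]
      exact e.2
    · exact absurd hxy doublePathSubdivision_not_adj_short_short
    · exact absurd hxy doublePathSubdivision_not_adj_short_long
  · have hu := doublePathSubdivision_adj_inl_long.1 hux
    have hadj := adj_ends e
    rcases y with v | q | ⟨e', j⟩
    · have hv := doublePathSubdivision_adj_inl_long.1 hxy.symm
      have huv : u ≠ v := fun h => huy (congrArg _ h)
      grind
    · exact absurd hxy.symm doublePathSubdivision_not_adj_short_long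
    · obtain ⟨rfl, hij⟩ := doublePathSubdivision_adj_long_long.1 hxy
      rcases z with v | q | ⟨e', k⟩
      · have hv := doublePathSubdivision_adj_inl_long.1 hyz.symm
        refine ⟨v, ?_, Or.inr rfl⟩
        rcases hu with ⟨rfl, rfl⟩ | ⟨rfl, rfl⟩ <;> rcases hv with ⟨rfl, rfl⟩ | ⟨rfl, rfl⟩
        · exact absurd rfl hij
        · exact hadj
        · exact hadj.symm
        · exact absurd rfl hij
      · exact absurd hyz.symm doublePathSubdivision_not_adj_short_long
      · obtain ⟨rfl, hjk⟩ := doublePathSubdivision_adj_long_long.1 hyz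
        have : i = k := by omega
        exact absurd (this ▸ rfl) hxz

lemma exists_inl_of_doublePathSubdivision_path
    {x y z : V ⊕ ((G.edgeSet × Fin (2 - 1)) ⊕ (G.edgeSet × Fin 2))}
    (hxy : (G.doublePathSubdivision 2).Adj x y) (hyz : (G.doublePathSubdivision 2).Adj y z)
    (hxz : x ≠ z) : ∃ u, x = Sum.inl u ∨ y = Sum.inl u ∨ z = Sum.inl u := by
  rcases y with u | p | ⟨e, i⟩
  · exact ⟨u, by simp⟩
  · rcases x with u | q | q
    · exact ⟨u, by simp⟩
    · exact absurd hxy doublePathSubdivision_not_adj_short_short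
    · exact absurd hxy.symm doublePathSubdivision_not_adj_short_long
  · rcases x with u | q | ⟨e', j⟩
    · exact ⟨u, by simp⟩
    · exact absurd hxy doublePathSubdivision_not_adj_short_long
    rcases z with u | q | ⟨e'', k⟩
    · exact ⟨u, by simp⟩
    · exact absurd hyz.symm doublePathSubdivision_not_adj_short_long
    obtain ⟨rfl, hji⟩ := doublePathSubdivision_adj_long_long.1 hxy
    obtain ⟨rfl, hik⟩ := doublePathSubdivision_adj_long_long.1 hyz
    have : j = k := by omega
    exact absurd (this ▸ rfl) hxz

/-- A 7-cycle in the subdivision yields a triangle in `G`. -/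
lemma exists_triangle_of_doublePathSubdivision_cycle
    (c : ZMod 7 → V ⊕ ((G.edgeSet × Fin (2 - 1)) ⊕ (G.edgeSet × Fin 2)))
    (hc : Function.Injective c)
    (hadj : ∀ i, (G.doublePathSubdivision 2).Adj (c i) (c (i + 1))) :
    ∃ u v w, G.Adj u v ∧ G.Adj v w ∧ G.Adj w u := by
  have hadj' (i j : ZMod 7) (h : i + 1 = j) : (G.doublePathSubdivision 2).Adj (c i) (c j) :=
    h ▸ hadj i
  have step (i : ZMod 7) (u : V) (hi : c i = Sum.inl u) :
      ∃ v, G.Adj u v ∧ (c (i + 2) = Sum.inl v ∨ c (i + 3) = Sum.inl v) := by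
    refine exists_adj_of_doublePathSubdivision_path (x := c (i + 1)) (hi ▸ hadj i)
      (hadj' _ (i + 2) (by ring)) (hadj' _ (i + 3) (by ring)) (hi ▸ hc.ne ?_) (hc.ne ?_)
    all_goals clear * -; revert i; decide
  have not_succ (i j : ZMod 7) (u v : V) (hi : c i = Sum.inl u) (hj : c j = Sum.inl v) :
      i + 1 ≠ j := by
    intro h
    have := hadj' i j h
    rw [hi, hj] at this
    exact doublePathSubdivision_not_adj_inl_inl this
  obtain ⟨i, u, hu⟩ : ∃ i u, c i = Sum.inl u := by
    obtain ⟨u, h | h | h⟩ := exists_inl_of_doublePathSubdivision_path (hadj' 0 1 rfl)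
      (hadj' 1 2 rfl) (hc.ne (by decide))
    exacts [⟨0, u, h⟩, ⟨1, u, h⟩, ⟨2, u, h⟩]
  have close (j : ZMod 7) (v : V) (hj : c j = Sum.inl v) (h : i = j) : v = u := by
    subst h
    exact Sum.inl_injective (hj.symm.trans hu)
  obtain ⟨v, huv, hv⟩ := step i u hu
  have key : ∃ w, G.Adj v w ∧ (c (i + 4) = Sum.inl w ∨ c (i + 5) = Sum.inl w) := by
    rcases hv with hv | hv <;> obtain ⟨w, hvw, hw | hw⟩ := step _ v hv
    · exact ⟨w, hvw, Or.inl (by rw [← hw]; congr 1; ring)⟩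
    · exact ⟨w, hvw, Or.inr (by rw [← hw]; congr 1; ring)⟩
    · exact ⟨w, hvw, Or.inr (by rw [← hw]; congr 1; ring)⟩
    · exact absurd (by clear * -; revert i; decide) (not_succ _ _ _ _ hw hu)
  obtain ⟨w, hvw, hw⟩ := key
  refine ⟨u, v, w, huv, hvw, ?_⟩
  rcases hw with hw | hw <;> obtain ⟨t, hwt, ht | ht⟩ := step _ w hw
  · exact absurd (by clear * -; revert i; decide) (not_succ _ _ _ _ ht hu)
  · exact close _ t ht (by clear * -; revert i; decide) ▸ hwt
  · exact close _ t ht (by clear * -; revert i; decide) ▸ hwt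
  · exact absurd (by clear * -; revert i; decide) (not_succ _ _ _ _ hu ht)

lemma exists_doublePathSubdivision_long_path {u v : V} (h : G.Adj u v) :
    ∃ i j : Fin 2, i ≠ j ∧
      (G.doublePathSubdivision 2).Adj (Sum.inl u) (Sum.inr (Sum.inr (⟨s(u, v), h⟩, i))) ∧
      (G.doublePathSubdivision 2).Adj (Sum.inl v) (Sum.inr (Sum.inr (⟨s(u, v), h⟩, j))) := by
  simp only [doublePathSubdivision_adj_inl_long]
  rcases Sym2.eq_iff.1 (mk_ends s(u, v)) with ⟨h₁, h₂⟩ | ⟨h₁, h₂⟩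
  · exact ⟨0, 1, by decide, Or.inl ⟨h₁.symm, rfl⟩, Or.inr ⟨h₂.symm, rfl⟩⟩
  · exact ⟨1, 0, by decide, Or.inr ⟨h₂.symm, rfl⟩, Or.inl ⟨h₁.symm, rfl⟩⟩

lemma tailedC7_isContained_of_triangle {a b c : V} (hab : G.Adj a b) (hbc : G.Adj b c)
    (hca : G.Adj c a) : tailedC7.IsContained (G.doublePathSubdivision 2) := by
  obtain ⟨i, j, hij, hi, hj⟩ := exists_doublePathSubdivision_long_path hca
  let f : Fin 8 → V ⊕ ((G.edgeSet × Fin (2 - 1)) ⊕ (G.edgeSet × Fin 2)) :=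
    ![Sum.inl a, Sum.inr (Sum.inl (⟨s(a, b), hab⟩, (0 : Fin 1))), Sum.inl b,
      Sum.inr (Sum.inl (⟨s(b, c), hbc⟩, (0 : Fin 1))), Sum.inl c,
      Sum.inr (Sum.inr (⟨s(c, a), hca⟩, i)), Sum.inr (Sum.inr (⟨s(c, a), hca⟩, j)),
      Sum.inr (Sum.inl (⟨s(c, a), hca⟩, (0 : Fin 1)))]
  have hf : Function.Injective f := by
    have := hab.ne
    have := hbc.ne
    have := hca.ne
    intro x y
    fin_cases x <;> fin_cases y <;> simp [f] <;> grind
  have hadj (x y : Fin 8) (h : ((x : ℕ) < 7 ∧ (y : ℕ) < 7 ∧ ((x : ℕ) + 1) % 7 = (y : ℕ)) ∨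
      ((x : ℕ) = 7 ∧ (y : ℕ) = 0)) : (G.doublePathSubdivision 2).Adj (f x) (f y) := by
    have short {u : V} {e : G.edgeSet} (hu : u ∈ e.1) : (G.doublePathSubdivision 2).Adj
        (Sum.inl u) (Sum.inr (Sum.inl (e, (0 : Fin 1)))) :=
      doublePathSubdivision_adj_inl_short.2 hu
    fin_cases x <;> fin_cases y <;> first | (exfalso; revert h; decide) | skip
    · exact short (by simp)
    · exact (short (by simp)).symm
    · exact short (by simp)
    · exact (short (by simp)).symm
    · exact hi
    · exact doublePathSubdivision_adj_long_long.2 ⟨rfl, hij⟩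
    · exact hj.symm
    · exact (short (by simp)).symm
  refine ⟨⟨⟨f, ?_⟩, hf⟩⟩
  rintro x y ⟨-, h | h⟩
  exacts [hadj x y h, (hadj y x h).symm]

end SimpleGraph

open SimpleGraph in
lemma tailedC7_isContained_iff {V : Type*} (G : SimpleGraph V) :
    tailedC7.IsContained (G.doublePathSubdivision 2) ↔
      (cycleGraph 3).IsContained G := by
  constructor
  · rintro ⟨f⟩
    obtain ⟨u, v, w, huv, hvw, hwu⟩ := exists_triangle_of_doublePathSubdivision_cycle
      (fun i : ZMod 7 => f (Fin.castSucc (show Fin 7 from i)))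
      (fun i j h => Fin.castSucc_injective 7 (f.injective h)) (fun i => f.toHom.map_adj (by
        revert i
        change ∀ i : Fin 7, tailedC7.Adj i.castSucc (i + 1).castSucc
        simp only [tailedC7, fromRel_adj]
        decide))
    refine ⟨⟨⟨![u, v, w], ?_⟩, ?_⟩⟩
    · intro x y h
      have hxy := h.ne
      fin_cases x <;> fin_cases y <;> simp_all [adj_comm]
    · have := huv.ne
      have := hvw.ne
      have := hwu.ne
      intro x y
      fin_cases x <;> fin_cases y <;> simp <;> grind
  · rintro ⟨f⟩
    have h (i j : Fin 3) (hij : i ≠ j) : G.Adj (f i) (f j) :=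
      f.toHom.map_adj (by rw [cycleGraph_three_eq_top]; exact hij)
    exact tailedC7_isContained_of_triangle (h 0 1 (by decide)) (h 1 2 (by decide))
      (h 2 0 (by decide))

/-- Let `G'` be obtained from a finite simple graph `G` by replacing every edge by
two internally disjoint paths of lengths 2 and 3 (the case `ℓ = 2` of the double
path construction). Then `G` contains no triangle if and only if `G'` contains no
subgraph isomorphic to `C₇` with a tail. -/
theorem triangle_free_iff_no_tailedC7 {V : Type*} [Fintype V] (G : SimpleGraph V) :
    (∀ S : G.Subgraph, ¬ Nonempty (S.coe ≃g SimpleGraph.cycleGraph 3)) ↔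
      (∀ S : (G.doublePathSubdivision 2).Subgraph, ¬ Nonempty (S.coe ≃g tailedC7)) := by
  have key {W : Type _} {U : Type} (H : SimpleGraph W) (K : SimpleGraph U) :
      (∀ S : H.Subgraph, ¬ Nonempty (S.coe ≃g K)) ↔ ¬ K.IsContained H := by
    rw [SimpleGraph.isContained_iff_exists_iso_subgraph, ← not_exists]
    exact not_congr (exists_congr fun S => ⟨fun ⟨e⟩ => ⟨e.symm⟩, fun ⟨e⟩ => ⟨e.symm⟩⟩)
  rw [key, key, tailedC7_isContained_iff]
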